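/- The wheel W_5 on 6 vertices is 4-colourable but not 3-colourable, and W_5 is not word-representable. -/

import Mathlib

/-- Two distinct letters `x` and `y` alternate in the word `w` if, after deleting all
letters other than `x` and `y` from `w`, no two consecutive letters of the resulting
word are equal (i.e. it reads `xyxy...` or `yxyx...`). -/
def Alternates {V : Type*} [DecidableEq V] (w : List V) (x y : V) : Prop :=
  List.Chain' (· ≠ ·) (w.filter fun z => z = x ∨ z = y)

/-- A finite simple graph `G = (V, E)` is word-representable if there is a word over the
alphabet `V` in which every element of `V` occurs at least once and such that, for all
distinct `x, y ∈ V`, the letters `x` and `y` alternate in the word iff `{x, y} ∈ E`. -/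
def WordRepresentable {V : Type*} [DecidableEq V] (G : SimpleGraph V) : Prop :=
  ∃ w : List V, (∀ v : V, v ∈ w) ∧
    ∀ x y : V, x ≠ y → (G.Adj x y ↔ Alternates w x y)

/-- The wheel graph `W_n` on `n + 1` vertices: a cycle on the `n` vertices `Sum.inl i`
(`i : Fin n`), together with one new hub vertex `Sum.inr ()` adjacent to all of them. -/
def wheelGraph (n : ℕ) : SimpleGraph (Fin n ⊕ Unit) :=
  SimpleGraph.fromRel fun a b =>
    match a, b with
    | Sum.inl i, Sum.inl j => ((i : ℕ) + 1) % n = (j : ℕ)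
    | Sum.inl _, Sum.inr _ => True
    | _, _ => False

/-- letter count among the first `n` letters -/
def cntZ {V : Type*} [DecidableEq V] (w : List V) (x : V) (n : ℕ) : ℤ :=
  ((w.take n).count x : ℤ)

/-- the count difference stays within `[d, d+1]` -/
def InBand {V : Type*} [DecidableEq V] (w : List V) (x y : V) (d : ℤ) : Prop :=
  ∀ n, d ≤ cntZ w x n - cntZ w y n ∧ cntZ w x n - cntZ w y n ≤ d + 1

theorem inBand_cons {V : Type*} [DecidableEq V] (z : V) (w : List V) (x y : V) (d : ℤ) :
    InBand (z :: w) x y d ↔ (d = 0 ∨ d = -1) ∧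
      InBand w x y (d - (if z = x then 1 else 0) + (if z = y then 1 else 0)) := by
  unfold InBand cntZ
  constructor
  · intro h
    refine ⟨?_, fun n => ?_⟩
    · have := h 0
      simp at this
      omega
    · have := h (n+1)
      simp only [List.take_succ_cons, List.count_cons, beq_iff_eq] at this
      split_ifs at * <;> push_cast at this <;> omega
  · rintro ⟨h0, h⟩ n
    cases n with
    | zero => simp; omega
    | succ n =>
      have := h n
      simp only [List.take_succ_cons, List.count_cons, beq_iff_eq]
      split_ifs at * <;> push_cast <;> omega

theorem inBand_zero {V : Type*} [DecidableEq V] {w : List V} {x y : V} {d : ℤ}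
    (h : InBand w x y d) : d = 0 ∨ d = -1 := by
  have := h 0
  simp [cntZ] at this
  omega

theorem inBand_iff {V : Type*} [DecidableEq V] (x y : V) (hxy : x ≠ y) (w : List V) :
    (InBand w x y 0 ↔ Alternates w x y ∧
      (w.filter fun z => z = x ∨ z = y).head? ≠ some y) ∧
    (InBand w x y (-1) ↔ Alternates w x y ∧
      (w.filter fun z => z = x ∨ z = y).head? ≠ some x) := by
  induction w with
  | nil => simp [InBand, cntZ, Alternates, List.Chain']
  | cons z w ih =>
    obtain ⟨h0, h1⟩ := ih
    have h2 : ¬ InBand w x y 1 := fun h => by have := inBand_zero h; omega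
    have h3 : ¬ InBand w x y (-2) := fun h => by have := inBand_zero h; omega
    rw [inBand_cons, inBand_cons]
    unfold Alternates List.Chain' at *
    by_cases hx : z = x
    · subst hx
      simp [hxy, h1, h3, List.isChain_cons]
      grind
    · by_cases hy : z = y
      · subst hy
        simp [hx, h0, h2, List.isChain_cons]
        grind
      · simp [hx, hy, h0, h1]

theorem alternates_iff {V : Type*} [DecidableEq V] (x y : V) (hxy : x ≠ y) (w : List V) :
    Alternates w x y ↔ ∃ d, InBand w x y d := by
  obtain ⟨h0, h1⟩ := inBand_iff x y hxy w
  constructor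
  · intro h
    by_cases hh : (w.filter fun z => z = x ∨ z = y).head? = some y
    · exact ⟨-1, h1.2 ⟨h, by rw [hh]; simpa using hxy.symm⟩⟩
    · exact ⟨0, h0.2 ⟨h, hh⟩⟩
  · rintro ⟨d, hd⟩
    rcases inBand_zero hd with rfl | rfl
    · exact (h0.1 hd).1
    · exact (h1.1 hd).1

instance wheel5Dec : DecidableRel (wheelGraph 5).Adj := fun a b =>
  decidable_of_iff (a ≠ b ∧ (match a, b with
    | Sum.inl i, Sum.inl j => decide (((i : ℕ) + 1) % 5 = (j : ℕ) ∨ ((j : ℕ) + 1) % 5 = (i : ℕ))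
    | Sum.inl _, Sum.inr _ => true
    | Sum.inr _, Sum.inl _ => true
    | Sum.inr _, Sum.inr _ => false : Bool) = true) (by
      rcases a with i | i <;> rcases b with j | j <;> simp [wheelGraph])
  

theorem wheel5_not_rep : ¬ WordRepresentable (wheelGraph 5) := by
  rintro ⟨w, -, hw⟩
  have hub : ∀ i : Fin 5, ∃ d, InBand w (Sum.inr ()) (Sum.inl i) d := fun i =>
    (alternates_iff _ _ (by simp) w).1 ((hw _ _ (by simp)).1 (by simp [wheelGraph]))
  choose d hd using hub
  let f : Fin 5 → ℕ → ℤ := fun i n => cntZ w (Sum.inl i) n + d i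
  have key : ∀ i j : Fin 5, i ≠ j →
      ((wheelGraph 5).Adj (Sum.inl i) (Sum.inl j) ↔ (f i ≤ f j ∨ f j ≤ f i)) := by
    intro i j hij
    rw [hw _ _ (by simpa using hij), alternates_iff _ _ (by simpa using hij)]
    constructor
    · rintro ⟨e, he⟩
      by_cases hc : e + d i - d j ≥ 0
      · right; intro n; have := he n; simp only [f]; omega
      · left; intro n; have := he n; simp only [f]; omega
    · rintro (h | h)
      · refine ⟨d j - d i - 1, fun n => ?_⟩
        have := h n; have := hd i n; have := hd j n; simp only [f] at *; omega
      · refine ⟨d j - d i, fun n => ?_⟩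
        have := h n; have := hd i n; have := hd j n; simp only [f] at *; omega
  have a01 := (key 0 1 (by decide)).1 (by decide)
  have a12 := (key 1 2 (by decide)).1 (by decide)
  have a23 := (key 2 3 (by decide)).1 (by decide)
  have a34 := (key 3 4 (by decide)).1 (by decide)
  have a40 := (key 4 0 (by decide)).1 (by decide)
  have n02 := mt (key 0 2 (by decide)).2 (by decide)
  have n13 := mt (key 1 3 (by decide)).2 (by decide)
  have n24 := mt (key 2 4 (by decide)).2 (by decide)
  have n30 := mt (key 3 0 (by decide)).2 (by decide)
  have n41 := mt (key 4 1 (by decide)).2 (by decide)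
  have T : ∀ i j k, f i ≤ f j → f j ≤ f k → f i ≤ f k := fun _ _ _ => le_trans
  clear_value f
  grind

theorem wheel5_not3 : ¬ (wheelGraph 5).Colorable 3 := by
  rintro ⟨c⟩
  have h0 := c.valid (show (wheelGraph 5).Adj (Sum.inl 0) (Sum.inl 1) by decide)
  have h1 := c.valid (show (wheelGraph 5).Adj (Sum.inl 1) (Sum.inl 2) by decide)
  have h2 := c.valid (show (wheelGraph 5).Adj (Sum.inl 2) (Sum.inl 3) by decide)
  have h3 := c.valid (show (wheelGraph 5).Adj (Sum.inl 3) (Sum.inl 4) by decide)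
  have h4 := c.valid (show (wheelGraph 5).Adj (Sum.inl 4) (Sum.inl 0) by decide)
  have g0 := c.valid (show (wheelGraph 5).Adj (Sum.inl 0) (Sum.inr ()) by decide)
  have g1 := c.valid (show (wheelGraph 5).Adj (Sum.inl 1) (Sum.inr ()) by decide)
  have g2 := c.valid (show (wheelGraph 5).Adj (Sum.inl 2) (Sum.inr ()) by decide)
  have g3 := c.valid (show (wheelGraph 5).Adj (Sum.inl 3) (Sum.inr ()) by decide)
  have g4 := c.valid (show (wheelGraph 5).Adj (Sum.inl 4) (Sum.inr ()) by decide)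
  omega

theorem wheel5_four : (wheelGraph 5).Colorable 4 :=
  ⟨SimpleGraph.Coloring.mk
    (fun v => match v with
      | Sum.inl i => (![0, 1, 0, 1, 2] : Fin 5 → Fin 4) i
      | Sum.inr _ => 3) (by decide)⟩

/-- The wheel `W_5` on 6 vertices is 4-colourable but not 3-colourable, and `W_5` is not
word-representable. -/
theorem wheel5_colorable_not_wordRepresentable :
    (wheelGraph 5).Colorable 4 ∧ ¬ (wheelGraph 5).Colorable 3 ∧
      ¬ WordRepresentable (wheelGraph 5) := 
  ⟨wheel5_four, wheel5_not3, wheel5_not_rep⟩
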